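/- arXiv:math/9904147 — 2 statements merged into one kernel-verified Lean document; each statement's English description precedes it below -/
import Mathlib

section
/- Let g ≥ 3 and s, d' be integers with 1 ≤ s ≤ g−1, d' ≥ η̂(s) and g−2 ≤ d' ≤ s+g−3. Set d₁ = 2g−3−d' and s₁ = s+g−2−d'. Then U_{d',s}(M) ∩ R = {(μ,λ) ∈ ℝ² : d₁−1 < μ < d₁, 0 < λ ≤ (1 − s/g)(μ−d₁) + s₁} ∪ {(d₁−1, λ) : 0 < λ < s₁−1}. -/
/-- The region BGN = {(μ,λ) : 0 < μ ≤ 1, 0 < λ ≤ (μ+g−1)/g} \ {(1,1)}. -/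
def BGN (g : ℝ) : Set (ℝ × ℝ) :=
  {p | 0 < p.1 ∧ p.1 ≤ 1 ∧ 0 < p.2 ∧ p.2 ≤ (p.1 + g - 1) / g} \ {((1 : ℝ), (1 : ℝ))}

/-- The region M = {(μ,λ) : 1 < μ < 2, 0 < λ ≤ (μ+g−1)/g} ∪ {(2,λ) : 0 < λ < 1}. -/
def Mreg (g : ℝ) : Set (ℝ × ℝ) :=
  {p | 1 < p.1 ∧ p.1 < 2 ∧ 0 < p.2 ∧ p.2 ≤ (p.1 + g - 1) / g} ∪
    {p | p.1 = 2 ∧ 0 < p.2 ∧ p.2 < 1}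

/-- The pentagonal region P = {(μ,λ) : μ < λ+g−1, μ ≥ 2λ−2, 0 ≤ μ ≤ 2g−2, λ > 0}. -/
def Preg (g : ℝ) : Set (ℝ × ℝ) :=
  {p | p.1 < p.2 + g - 1 ∧ 2 * p.2 - 2 ≤ p.1 ∧ 0 ≤ p.1 ∧ p.1 ≤ 2 * g - 2 ∧ 0 < p.2}

/-- The region R = {(μ,λ) ∈ P : μ ≤ g−1}. -/
def Rreg (g : ℝ) : Set (ℝ × ℝ) := {p ∈ Preg g | p.1 ≤ g - 1}

/-- The affine map T_{d',s}(μ,λ) = (μ+d', sλ). -/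
def Tmap (d' : ℝ) (s : ℤ) (p : ℝ × ℝ) : ℝ × ℝ := (p.1 + d', (s : ℝ) * p.2)

/-- The Serre duality map σ(μ,λ) = (2g−2−μ, λ+g−1−μ). -/
def serre (g : ℝ) (p : ℝ × ℝ) : ℝ × ℝ := (2 * g - 2 - p.1, p.2 + g - 1 - p.1)

/-- The map U_{d',s} = σ ∘ T_{d',s}. -/
def Umap (g d' : ℝ) (s : ℤ) (p : ℝ × ℝ) : ℝ × ℝ := serre g (Tmap d' s p)

/-- η(s) = (s−1)(s+g)/s. -/
def eta (g s : ℤ) : ℚ := ((s : ℚ) - 1) * ((s : ℚ) + (g : ℚ)) / (s : ℚ)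

/-- η̂(s) = ⌈η(s)⌉. -/
def etaHat (g s : ℤ) : ℤ := ⌈eta g s⌉

/-- The bound `η̂(s) ≤ d'` forces `2s - 2 ≤ d'` whenever `1 ≤ s ≤ g`. -/
theorem two_mul_sub_two_le_of_etaHat_le {g s d' : ℤ} (hs : 1 ≤ s) (hsg : s ≤ g)
    (hd' : etaHat g s ≤ d') : 2 * s - 2 ≤ d' := by
  have hs0 : (0 : ℚ) < s := by exact_mod_cast hs
  have h := Int.ceil_le.mp hd'
  rw [eta, div_le_iff₀ hs0] at h
  have h' : (s - 1) * (s + g) ≤ d' * s := by exact_mod_cast h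
  nlinarith [mul_nonneg (sub_nonneg.mpr hs) (sub_nonneg.mpr hsg)]

/-- Explicit description of U_{d',s}(M) ∩ R. -/
theorem Umap_image_M_inter_R (g s d' : ℤ) (hg : 3 ≤ g) (hs : 1 ≤ s) (hs' : s ≤ g - 1)
    (hd' : etaHat g s ≤ d') (hd'1 : g - 2 ≤ d') (hd'2 : d' ≤ s + g - 3)
    (d₁ s₁ : ℤ) (hd₁ : d₁ = 2 * g - 3 - d') (hs₁ : s₁ = s + g - 2 - d') :
    (Umap (g : ℝ) (d' : ℝ) s '' Mreg (g : ℝ)) ∩ Rreg (g : ℝ) =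
      {p : ℝ × ℝ | (d₁ : ℝ) - 1 < p.1 ∧ p.1 < (d₁ : ℝ) ∧ 0 < p.2 ∧
          p.2 ≤ (1 - (s : ℝ) / (g : ℝ)) * (p.1 - (d₁ : ℝ)) + (s₁ : ℝ)} ∪
        {p : ℝ × ℝ | p.1 = (d₁ : ℝ) - 1 ∧ 0 < p.2 ∧ p.2 < (s₁ : ℝ) - 1} := by
  have hd := two_mul_sub_two_le_of_etaHat_le hs (by lia) hd'
  have hgR : (3 : ℝ) ≤ g := by exact_mod_cast hg
  have hsR : (1 : ℝ) ≤ s := by exact_mod_cast hs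
  have hsgR : (s : ℝ) ≤ g - 1 := by exact_mod_cast hs'
  have hdR : 2 * (s : ℝ) - 2 ≤ d' := by exact_mod_cast hd
  have hdgR : (g : ℝ) - 2 ≤ d' := by exact_mod_cast hd'1
  have hdsR : (d' : ℝ) ≤ s + g - 3 := by exact_mod_cast hd'2
  have hd₁R : (d₁ : ℝ) = 2 * g - 3 - d' := by exact_mod_cast hd₁
  have hs₁R : (s₁ : ℝ) = s + g - 2 - d' := by exact_mod_cast hs₁
  clear hd hg hs hs' hd' hd'1 hd'2 hd₁ hs₁
  have hg0 : (0 : ℝ) < g := by linarith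
  have hs0 : (0 : ℝ) < s := by linarith
  obtain ⟨c, hc⟩ : ∃ c : ℝ, c = (s : ℝ) / g := ⟨_, rfl⟩
  have hcg : c * g = s := by rw [hc]; field_simp
  have hc1 : c ≤ 1 := by rw [hc, div_le_one hg0]; linarith
  rw [← hc]
  ext ⟨m, l⟩
  simp only [Set.mem_inter_iff, Set.mem_image, Set.mem_union, Set.mem_ofPred_eq, Mreg, Rreg, Preg,
    Umap, Tmap, serre, Prod.exists, Prod.mk.injEq]
  constructor
  · rintro ⟨⟨μ, x, h, rfl, rfl⟩, ⟨-, -, -, -, hl⟩, -⟩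
    rcases h with ⟨h1, h2, -, h4⟩ | ⟨rfl, -, h4⟩
    · refine Or.inl ⟨by linarith, by linarith, hl, ?_⟩
      have h5 : (s : ℝ) * x ≤ c * (μ + g - 1) := by
        calc (s : ℝ) * x ≤ s * ((μ + g - 1) / g) := by gcongr
          _ = c * (μ + g - 1) := by rw [hc]; ring
      rw [hd₁R, hs₁R]
      linarith
    · exact Or.inr ⟨by linarith, hl, by nlinarith⟩
  · intro h
    refine ⟨⟨d₁ + 1 - m, (l - m + g - 1) / s, ?_, by linarith, ?_⟩, ?_⟩
    · rcases h with ⟨h1, h2, h3, h4⟩ | ⟨rfl, h3, h4⟩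
      · refine Or.inl ⟨by linarith, by linarith, div_pos (by linarith) hs0, ?_⟩
        have h5 : l - m + g - 1 ≤ c * (d₁ + 1 - m + g - 1) := by linarith
        rw [div_le_iff₀ hs0]
        calc l - m + g - 1 ≤ c * (d₁ + 1 - m + g - 1) := h5
          _ = (d₁ + 1 - m + g - 1) / g * s := by rw [hc]; ring
      · refine Or.inr ⟨by ring, div_pos (by linarith) hs0, ?_⟩
        rw [div_lt_one hs0]
        linarith
    · rw [mul_div_cancel₀ _ hs0.ne']
      linarith
    · rcases h with ⟨h1, h2, h3, h4⟩ | ⟨rfl, h3, h4⟩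
      · have h5 : 0 ≤ (1 - c) * (d₁ - m) :=
          mul_nonneg (sub_nonneg.mpr hc1) (sub_nonneg.mpr h2.le)
        refine ⟨⟨by linarith, by linarith, by linarith, by linarith, h3⟩, by linarith⟩
      · exact ⟨⟨by linarith, by linarith, by linarith, by linarith, h3⟩, by linarith⟩
end

section
/- For every integer g ≥ 3 and every real μ with 0 < μ ≤ g−1, one has 0 ≤ ρ_g(μ) − t_g(μ) < 1. -/
/-- η̂'(s) = ⌈η(s) + 1/s⌉ − 1. -/
def etaHat' (g s : ℤ) : ℤ := ⌈eta g s + 1 / (s : ℚ)⌉ - 1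

/-- The function ρ_g parametrizing the Brill–Noether curve. -/
noncomputable def rhoG (g μ : ℝ) : ℝ :=
  (Real.sqrt ((μ - g + 1) ^ 2 + 4 * (g - 1)) + μ - g + 1) / 2

/-- The function `x ↦ x + (g - 1) - (g - 1) / x`, the inverse of `rhoG g` on positive reals. -/
noncomputable def rhoGInv (g x : ℝ) : ℝ := x + (g - 1) - (g - 1) / x

theorem le_rhoG_iff {g μ x : ℝ} (hg : 1 < g) (hx : 0 < x) :
    x ≤ rhoG g μ ↔ rhoGInv g x ≤ μ := by
  have hD : 0 ≤ (μ - g + 1) ^ 2 + 4 * (g - 1) := by nlinarith [sq_nonneg (μ - g + 1)]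
  have hsq := Real.sq_sqrt hD
  have hlt : |μ - g + 1| < √((μ - g + 1) ^ 2 + 4 * (g - 1)) :=
    Real.lt_sqrt_of_sq_lt (by rw [sq_abs]; linarith)
  have hr : 0 < rhoG g μ := by
    unfold rhoG; linarith [neg_abs_le (μ - g + 1)]
  have hroot : rhoG g μ ^ 2 = (μ - g + 1) * rhoG g μ + (g - 1) := by
    unfold rhoG; linear_combination hsq / 4
  have hinv : rhoGInv g x - μ = (x - rhoG g μ) * (1 + (g - 1) / (x * rhoG g μ)) := by
    unfold rhoGInv
    field_simp
    linear_combination x * hroot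
  have hpos : 0 < 1 + (g - 1) / (x * rhoG g μ) := by
    have : 0 < g - 1 := by linarith
    positivity
  rw [← sub_nonpos, ← sub_nonpos (a := rhoGInv g x), hinv]
  constructor
  · exact fun h => mul_nonpos_of_nonpos_of_nonneg h hpos.le
  · exact fun h => nonpos_of_mul_nonpos_left h hpos

theorem rhoG_lt_iff {g μ x : ℝ} (hg : 1 < g) (hx : 0 < x) :
    rhoG g μ < x ↔ μ < rhoGInv g x := by
  simpa only [not_le] using (le_rhoG_iff hg hx).not

theorem rhoGInv_add_sub_le {g x y : ℝ} (hg : 1 < g) (hx : 0 < x) (hxy : x ≤ y) :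
    rhoGInv g x + (y - x) ≤ rhoGInv g y := by
  have : (g - 1) / y ≤ (g - 1) / x := div_le_div_of_nonneg_left (by linarith) hx hxy
  unfold rhoGInv
  linarith

theorem cast_eta_add_one_div (g : ℤ) {s : ℤ} (hs : s ≠ 0) :
    ((eta g s + 1 / (s : ℚ) : ℚ) : ℝ) = rhoGInv g s := by
  have : (s : ℝ) ≠ 0 := by exact_mod_cast hs
  unfold eta rhoGInv
  push_cast
  field_simp
  ring

theorem etaHat'_lt (g : ℤ) {s : ℤ} (hs : s ≠ 0) : (etaHat' g s : ℝ) < rhoGInv g s := by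
  rw [← cast_eta_add_one_div g hs]
  have h := Int.ceil_lt_add_one (eta g s + 1 / (s : ℚ))
  have h' : (etaHat' g s : ℚ) < eta g s + 1 / (s : ℚ) := by
    unfold etaHat'; push_cast at h ⊢; linarith
  exact_mod_cast h'

theorem le_etaHat'_add_one (g : ℤ) {s : ℤ} (hs : s ≠ 0) :
    rhoGInv g s ≤ (etaHat' g s : ℝ) + 1 := by
  rw [← cast_eta_add_one_div g hs]
  have h := Int.le_ceil (eta g s + 1 / (s : ℚ))
  have h' : eta g s + 1 / (s : ℚ) ≤ (etaHat' g s : ℚ) + 1 := by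
    unfold etaHat'; push_cast at h ⊢; linarith
  exact_mod_cast h'

theorem etaHat'_one (g : ℤ) : etaHat' g 1 = 0 := by
  simp [etaHat', eta]

theorem exists_etaHat'_lt_le {g : ℤ} (hg : 1 ≤ g) {μ : ℝ} (hμ : 0 < μ) :
    ∃ s : ℤ, 1 ≤ s ∧ (etaHat' g s : ℝ) < μ ∧ μ ≤ (etaHat' g (s + 1) : ℝ) := by
  by_contra! h
  have hall (n : ℕ) : (etaHat' g ((n : ℤ) + 1) : ℝ) < μ := by
    induction n with
    | zero => simpa [etaHat'_one] using hμ
    | succ n ih => exact_mod_cast h _ (by lia) ih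
  obtain ⟨n, hn⟩ := exists_nat_gt μ
  have hle := le_etaHat'_add_one g (s := (n : ℤ) + 1) (by lia)
  have hg' : (0 : ℝ) ≤ (g : ℝ) - 1 := by
    have : (1 : ℝ) ≤ g := by exact_mod_cast hg
    linarith
  have hdiv : ((g : ℝ) - 1) / ((n : ℝ) + 1) ≤ (g : ℝ) - 1 :=
    div_le_self hg' (by linarith [Nat.cast_nonneg (α := ℝ) n])
  have hlt := hall n
  unfold rhoGInv at hle
  push_cast at hle
  linarith

/-- For 0 < μ ≤ g−1 one has 0 ≤ ρ_g(μ) − t_g(μ) < 1, where t_g is the upper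
boundary function of Teixidor's region, specified by its defining clauses
(in terms of the unique integer s ≥ 1 with η̂'(s) < μ ≤ η̂'(s+1)). -/
theorem rhoG_sub_tg (g : ℤ) (hg : 3 ≤ g) (t : ℝ → ℝ)
    (ht : ∀ (μ : ℝ) (s : ℤ), 1 ≤ s → 0 < μ → μ ≤ (g : ℝ) - 1 →
      (etaHat' g s : ℝ) < μ → μ ≤ (etaHat' g (s + 1) : ℝ) →
      ((μ ≤ (etaHat' g s : ℝ) + 1 → t μ = μ - (⌈μ⌉ : ℝ) + (s : ℝ)) ∧
       ((etaHat' g s : ℝ) + 1 < μ → t μ = (s : ℝ)))) :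
    ∀ μ : ℝ, 0 < μ → μ ≤ (g : ℝ) - 1 →
      0 ≤ rhoG (g : ℝ) μ - t μ ∧ rhoG (g : ℝ) μ - t μ < 1 := by
  intro μ hμ hμg
  have hg' : (1 : ℝ) < g := by exact_mod_cast (by lia : (1 : ℤ) < g)
  obtain ⟨s, hs, hlt, hle⟩ := exists_etaHat'_lt_le (by lia : 1 ≤ g) hμ
  obtain ⟨hlow, hhigh⟩ := ht μ s hs hμ hμg hlt hle
  have hs' : (1 : ℝ) ≤ s := by exact_mod_cast hs
  have hElt := etaHat'_lt g (by lia : s ≠ 0)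
  have hleE := le_etaHat'_add_one g (by lia : s ≠ 0)
  rw [sub_nonneg, sub_lt_iff_lt_add']
  rcases le_or_gt μ ((etaHat' g s : ℝ) + 1) with hμE | hμE
  · have hceil : ⌈μ⌉ = etaHat' g s + 1 := by
      rw [Int.ceil_eq_iff]
      push_cast
      exact ⟨by linarith, hμE⟩
    have htμ := hlow hμE
    rw [hceil] at htμ
    push_cast at htμ
    rw [le_rhoG_iff hg' (by linarith), rhoG_lt_iff hg' (by linarith)]
    have hl := rhoGInv_add_sub_le hg' (x := t μ) (y := s) (by linarith) (by linarith)
    have hu := rhoGInv_add_sub_le hg' (x := s) (y := t μ + 1) (by linarith) (by linarith)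
    exact ⟨by linarith, by linarith⟩
  · rw [hhigh hμE, le_rhoG_iff hg' (by linarith), rhoG_lt_iff hg' (by linarith)]
    have hE := etaHat'_lt g (by lia : s + 1 ≠ 0)
    push_cast at hE
    exact ⟨by linarith, by linarith⟩
end
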